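/- Fix z ∈ ℤ. For any sequence (y₁(k), y₂(k)) in ℤ² with |y₁(k)| → ∞ and y₁(k)/y₂(k)² → +∞ or −∞ (in particular this includes y₂(k) bounded), the sequence √|y₁(k)| · ∫_{−π}^{π} e^{i t (y₁(k) − z)} · ψ(t)^{|y₂(k)|}/(1 − φ(t)) dt converges to a nonzero constant. -/

import Mathlib

open Filter Real Complex

noncomputable section

/-- `w(t) = 3 - 2 exp(it)`. -/
def wFn (t : ℝ) : ℂ := 3 - 2 * Complex.exp (Complex.I * t)

/-- `ψ(t) = w(t) - √(w(t)²-1)` (principal branch of the complex square root). -/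
def psiFn (t : ℝ) : ℂ := wFn t - (wFn t ^ 2 - 1) ^ ((1 : ℂ) / 2)

/-- `φ(t) = Re(w(t)·ψ(t))`. -/
def phiFn (t : ℝ) : ℝ := (wFn t * psiFn t).re

/-- The square root `√(w²-1)`. -/
def sFn (t : ℝ) : ℂ := (wFn t ^ 2 - 1) ^ ((1 : ℂ) / 2)

/-- The derivative of `w`. -/
def wFn' (t : ℝ) : ℂ := -2 * Complex.I * Complex.exp (Complex.I * t)

lemma psi_eq (t : ℝ) : psiFn t = wFn t - sFn t := rfl

lemma sFn_sq (t : ℝ) : sFn t ^ 2 = wFn t ^ 2 - 1 := by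
  unfold sFn
  simp

lemma wFn_re (t : ℝ) : (wFn t).re = 3 - 2 * Real.cos t := by
  have : Complex.I * t = t * Complex.I := mul_comm _ _
  simp [wFn, this, Complex.exp_ofReal_mul_I_re]

lemma wFn_im (t : ℝ) : (wFn t).im = - 2 * Real.sin t := by
  have : Complex.I * t = t * Complex.I := mul_comm _ _
  simp [wFn, this, Complex.exp_ofReal_mul_I_im]

lemma sFn_re_nonneg (t : ℝ) : 0 ≤ (sFn t).re := by
  unfold sFn
  have h : ((1 : ℂ) / 2) = ((1 / 2 : ℝ) : ℂ) := by push_cast; rfl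
  rw [h, Complex.cpow_ofReal_re]
  have h1 := Complex.neg_pi_lt_arg (wFn t ^ 2 - 1)
  have h2 := Complex.arg_le_pi (wFn t ^ 2 - 1)
  refine mul_nonneg (by positivity) (Real.cos_nonneg_of_mem_Icc ⟨by linarith, by linarith⟩)

lemma q_re (t : ℝ) : (wFn t ^ 2 - 1).re = 4 * (1 - Real.cos t) * (1 - 2 * Real.cos t) := by
  simp only [pow_two, Complex.sub_re, Complex.mul_re, wFn_re, wFn_im, Complex.one_re]
  nlinarith [Real.sin_sq_add_cos_sq t]

lemma q_im (t : ℝ) : (wFn t ^ 2 - 1).im = - 4 * Real.sin t * (3 - 2 * Real.cos t) := by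
  simp only [pow_two, Complex.sub_im, Complex.mul_im, wFn_re, wFn_im, Complex.one_im]
  ring

lemma q_slit {t : ℝ} (h0 : 0 < t) (hpi : t ≤ π) : wFn t ^ 2 - 1 ∈ slitPlane := by
  rw [Complex.mem_slitPlane_iff, q_re, q_im]
  rcases hpi.eq_or_lt with h | h
  · left; subst h; norm_num
  · right
    have := Real.sin_pos_of_pos_of_lt_pi h0 h
    have := Real.cos_le_one t
    have : 0 < 3 - 2 * Real.cos t := by linarith
    positivity

lemma sqrt_half_le (t : ℝ) (h0 : 0 ≤ t) (hpi : t ≤ π) : √t / 2 ≤ (sFn t).re := by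
  set r := (sFn t).re with hr
  set v := (sFn t).im with hv
  have hs := sFn_sq t
  have e1 : r ^ 2 - v ^ 2 = 4 * (1 - Real.cos t) * (1 - 2 * Real.cos t) := by
    rw [← q_re, ← hs]; simp [pow_two, hr, hv]
  have e2 : 2 * r * v = - 4 * Real.sin t * (3 - 2 * Real.cos t) := by
    rw [← q_im, ← hs]; simp [pow_two, hr, hv]; ring
  have hσ := Real.mul_le_sin (x := t / 2) (by linarith) (by linarith)
  set σ := Real.sin (t / 2) with hσd
  have hc : Real.cos t = 1 - 2 * σ ^ 2 := by
    have := Real.cos_two_mul (t / 2)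
    have h2 := Real.sin_sq_add_cos_sq (t / 2)
    rw [show 2 * (t / 2) = t by ring] at this
    rw [this]; linarith
  have hσ1 : σ ≤ 1 := Real.sin_le_one _
  have hpi4 := Real.pi_le_four
  have hσt : t / 4 ≤ σ := by
    refine le_trans ?_ hσ
    rw [show 2 / π * (t / 2) = t / π by ring]
    exact div_le_div_of_nonneg_left h0 Real.pi_pos hpi4
  have hσ0 : 0 ≤ σ := by linarith
  have hn : (r ^ 2 + v ^ 2) ^ 2 = 64 * σ ^ 2 * (1 + 8 * σ ^ 2) := by
    have : (r ^ 2 + v ^ 2) ^ 2 = (r ^ 2 - v ^ 2) ^ 2 + (2 * r * v) ^ 2 := by ring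
    rw [this, e1, e2]
    have h3 : (- 4 * Real.sin t * (3 - 2 * Real.cos t)) ^ 2
      = 16 * (1 - Real.cos t ^ 2) * (3 - 2 * Real.cos t) ^ 2 := by
      have := Real.sin_sq_add_cos_sq t
      rw [show (1 - Real.cos t ^ 2) = Real.sin t ^ 2 by linarith]; ring
    rw [h3, hc]; ring
  have hn2 : 8 * σ ≤ r ^ 2 + v ^ 2 := by
    apply le_of_sq_le_sq _ (by positivity)
    rw [hn]; nlinarith [sq_nonneg (σ ^ 2)]
  have hr2 : 2 * σ ≤ r ^ 2 := by
    rw [hc] at e1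
    have : 0 ≤ σ * (4 * σ ^ 3 - σ + 1 / 2) := by
      apply mul_nonneg hσ0
      nlinarith [sq_nonneg (σ - 1 / 3), mul_nonneg hσ0 (sq_nonneg (σ - 1 / 3))]
    nlinarith
  have : √t / 2 = √(t / 4) := by
    rw [Real.sqrt_div h0, show (4 : ℝ) = 2 ^ 2 by norm_num]; simp
  rw [this]
  apply Real.sqrt_le_iff.2 ⟨sFn_re_nonneg t, by nlinarith⟩

lemma wFn_norm_le (t : ℝ) : ‖wFn t‖ ≤ 5 := by
  unfold wFn
  refine (norm_sub_le _ _).trans ?_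
  rw [norm_mul, mul_comm Complex.I, Complex.norm_exp_ofReal_mul_I]; norm_num

lemma wderFn_norm (t : ℝ) : ‖wFn' t‖ = 2 := by
  unfold wFn'
  rw [norm_mul, mul_comm Complex.I, Complex.norm_exp_ofReal_mul_I]; simp

lemma sFn_norm_le (t : ℝ) : ‖sFn t‖ ≤ 6 := by
  have h : ‖sFn t‖ ^ 2 ≤ 26 := by
    rw [← norm_pow, sFn_sq]
    refine (norm_sub_le _ _).trans ?_
    rw [norm_pow]; have := wFn_norm_le t; simp; nlinarith [norm_nonneg (wFn t)]
  nlinarith [norm_nonneg (sFn t)]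

lemma psi_mul (t : ℝ) : psiFn t * (wFn t + sFn t) = 1 := by
  rw [psi_eq]; linear_combination - sFn_sq t

lemma psi_norm (t : ℝ) : ‖psiFn t‖ * (1 + (sFn t).re) ≤ 1 := by
  have h : ‖psiFn t‖ * ‖wFn t + sFn t‖ = 1 := by rw [← norm_mul, psi_mul]; simp
  rw [← h]
  gcongr
  refine le_trans ?_ (Complex.re_le_norm _)
  rw [Complex.add_re, wFn_re]; linarith [Real.cos_le_one t]

lemma psi_norm_le_one (t : ℝ) : ‖psiFn t‖ ≤ 1 := by
  nlinarith [psi_norm t, sFn_re_nonneg t, norm_nonneg (psiFn t)]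

lemma one_sub_phi (t : ℝ) : 1 - phiFn t = (sFn t * psiFn t).re := by
  have h : 1 - wFn t * psiFn t = sFn t * psiFn t := by
    linear_combination - psi_mul t
  unfold phiFn; rw [← h]; simp

lemma two_one_sub_phi (t : ℝ) : 2 * (1 - phiFn t) = 1 - (psiFn t ^ 2).re := by
  have h : 2 * (sFn t * psiFn t) = 1 - psiFn t ^ 2 := by
    have := psi_mul t
    rw [psi_eq] at *
    linear_combination this
  rw [one_sub_phi]
  have := congrArg Complex.re h
  simpa using this

lemma phi_bound (t : ℝ) (h0 : 0 ≤ t) (hpi : t ≤ π) : √t / 28 ≤ 1 - phiFn t := by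
  have h1 := two_one_sub_phi t
  have h2 : (psiFn t ^ 2).re ≤ ‖psiFn t‖ ^ 2 := by
    rw [← norm_pow]; exact Complex.re_le_norm _
  have h3 := psi_norm t
  have h4 := psi_norm_le_one t
  have h5 := sqrt_half_le t h0 hpi
  have h6 : (sFn t).re ≤ 6 := (Complex.re_le_norm _).trans (sFn_norm_le t)
  have h7 := sFn_re_nonneg t
  have h8 : (sFn t).re / 7 ≤ 1 - ‖psiFn t‖ := by
    have : (1 - ‖psiFn t‖) * (1 + (sFn t).re) ≥ (sFn t).re := by nlinarith
    nlinarith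
  nlinarith [norm_nonneg (psiFn t)]

lemma m_psi_bound (m : ℕ) (t : ℝ) : m * ‖psiFn t‖ ^ m * (sFn t).re ≤ 1 := by
  have h7 := sFn_re_nonneg t
  have hb := one_add_mul_le_pow (a := (sFn t).re) (by linarith) m
  have h := pow_le_one₀ (n := m) (by positivity) (psi_norm t)
  rw [mul_pow] at h
  have h9 : 0 ≤ ‖psiFn t‖ ^ m := by positivity
  nlinarith

lemma hasDerivAt_w (t : ℝ) : HasDerivAt wFn (wFn' t) t := by
  unfold wFn wFn'
  have h1 : HasDerivAt (fun t : ℝ => Complex.I * (t : ℂ)) Complex.I t := by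
    simpa using (Complex.ofRealCLM.hasDerivAt (x := t)).const_mul Complex.I
  have := (h1.cexp.const_mul 2).const_sub 3
  refine this.congr_deriv ?_
  ring

lemma hasDerivAt_s {t : ℝ} (h0 : 0 < t) (hpi : t ≤ π) :
    HasDerivAt sFn (wFn t * wFn' t / sFn t) t := by
  have hq : HasDerivAt (fun t => wFn t ^ 2 - 1) (2 * wFn t * wFn' t) t := by
    simpa using ((hasDerivAt_w t).pow 2).sub_const 1
  have hsl := q_slit h0 hpi
  have hne := Complex.slitPlane_ne_zero hsl
  have h := ((hasDerivAt_id (wFn t ^ 2 - 1)).cpow_const (c := (1 : ℂ) / 2) hsl).comp t hq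
  refine h.congr_deriv ?_
  have hs : sFn t ≠ 0 := by
    intro h; apply hne; rw [← sFn_sq, h]; simp
  rw [id_eq, Complex.cpow_sub _ _ hne, Complex.cpow_one]
  change 1 / 2 * (sFn t / (wFn t ^ 2 - 1)) * 1 * _ = _
  rw [← sFn_sq]; field_simp

lemma s_ne {t : ℝ} (h0 : 0 < t) (hpi : t ≤ π) : sFn t ≠ 0 := by
  intro h
  apply Complex.slitPlane_ne_zero (q_slit h0 hpi); rw [← sFn_sq, h]; simp

lemma hasDerivAt_psi {t : ℝ} (h0 : 0 < t) (hpi : t ≤ π) :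
    HasDerivAt psiFn (-(wFn' t * psiFn t / sFn t)) t := by
  have hs := s_ne h0 hpi
  refine ((hasDerivAt_w t).sub (hasDerivAt_s h0 hpi)).congr_deriv ?_
  rw [psi_eq]; field_simp; ring

/-- The derivative of `φ`. -/
def phiFn' (t : ℝ) : ℝ := -(wFn' t * psiFn t ^ 2 / sFn t).re

lemma hasDerivAt_phi {t : ℝ} (h0 : 0 < t) (hpi : t ≤ π) :
    HasDerivAt phiFn (phiFn' t) t := by
  have h := (((hasDerivAt_psi h0 hpi).pow 2).const_sub 1)
  have h2 := (Complex.reCLM.hasFDerivAt.comp_hasDerivAt t h).div_const 2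
  have h3 := h2.const_sub 1
  have e : phiFn = fun x => 1 - (Complex.reCLM ∘ fun x => 1 - psiFn x ^ 2) x / 2 := by
    funext x
    have := two_one_sub_phi x
    simp only [Function.comp, Complex.reCLM_apply, Complex.sub_re, Complex.one_re]
    linarith
  rw [e]
  refine HasDerivAt.congr_deriv h3 ?_
  simp only [phiFn', Complex.reCLM_apply]
  have : ∀ z : ℂ, z.re / 2 = (z / 2).re := by intro z; simp
  rw [this, ← Complex.neg_re, ← Complex.neg_re]
  congr 1
  push_cast
  ring

/-- The integrand profile. -/
def fFn (m : ℕ) (t : ℝ) : ℂ := psiFn t ^ m / (1 - (phiFn t : ℂ))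

/-- Its derivative. -/
def fFn' (m : ℕ) (t : ℝ) : ℂ :=
  -(m * psiFn t ^ m * wFn' t / (sFn t * ((1 - phiFn t : ℝ) : ℂ))) +
    psiFn t ^ m * phiFn' t / ((1 - phiFn t : ℝ) : ℂ) ^ 2

lemma phi_pos {t : ℝ} (h0 : 0 < t) (hpi : t ≤ π) : 0 < 1 - phiFn t :=
  lt_of_lt_of_le (by have := Real.sqrt_pos.2 h0; positivity) (phi_bound t h0.le hpi)

lemma hasDerivAt_f (m : ℕ) {t : ℝ} (h0 : 0 < t) (hpi : t ≤ π) :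
    HasDerivAt (fFn m) (fFn' m t) t := by
  have hp := phi_pos h0 hpi
  have hpc : ((1 : ℂ) - phiFn t) ≠ 0 := by
    have : (((1 - phiFn t : ℝ)) : ℂ) ≠ 0 := by exact_mod_cast hp.ne'
    simpa using this
  have hs := s_ne h0 hpi
  have h := ((hasDerivAt_psi h0 hpi).pow m).div
    ((hasDerivAt_phi h0 hpi).ofReal_comp.const_sub 1) hpc
  refine h.congr_deriv ?_
  unfold fFn'
  push_cast
  rcases m with _ | m
  · simp
  · simp only [Nat.add_sub_cancel, pow_succ, Pi.pow_apply]
    push_cast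
    field_simp
    ring

lemma f_bound (m : ℕ) {t : ℝ} (h0 : 0 < t) (hpi : t ≤ π) : ‖fFn m t‖ ≤ 28 / √t := by
  have hs := Real.sqrt_pos.2 h0
  have hp := phi_bound t h0.le hpi
  unfold fFn
  rw [norm_div, norm_pow, ← Complex.ofReal_one, ← Complex.ofReal_sub, Complex.norm_real,
    Real.norm_eq_abs, abs_of_pos (phi_pos h0 hpi)]
  calc _ ≤ 1 / (√t / 28) := by
        gcongr
        exact pow_le_one₀ (norm_nonneg _) (psi_norm_le_one t)
    _ = _ := by field_simp

lemma s_norm_ge {t : ℝ} (h0 : 0 < t) (hpi : t ≤ π) : √t / 2 ≤ ‖sFn t‖ :=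
  (sqrt_half_le t h0.le hpi).trans (Complex.re_le_norm _)

lemma fder_bound (m : ℕ) {t : ℝ} (h0 : 0 < t) (hpi : t ≤ π) :
    ‖fFn' m t‖ ≤ 4000 / (t * √t) := by
  have hs := Real.sqrt_pos.2 h0
  have hp := phi_bound t h0.le hpi
  have hpp := phi_pos h0 hpi
  have hsn := s_norm_ge h0 hpi
  have hψ := psi_norm_le_one t
  have hψm : ∀ n, ‖psiFn t‖ ^ n ≤ 1 := fun n => pow_le_one₀ (norm_nonneg _) hψ
  have hm : m * ‖psiFn t‖ ^ m ≤ 2 / √t := by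
    have h1 := m_psi_bound m t
    have h2 := sqrt_half_le t h0.le hpi
    rw [le_div_iff₀ hs]
    have : 0 ≤ m * ‖psiFn t‖ ^ m := by positivity
    nlinarith
  have hφ' : |phiFn' t| ≤ 4 / √t := by
    unfold phiFn'
    rw [abs_neg]
    refine (Complex.abs_re_le_norm _).trans ?_
    rw [norm_div, norm_mul, norm_pow, wderFn_norm]
    calc _ ≤ 2 * 1 / (√t / 2) := by gcongr; exact hψm 2
      _ = _ := by field_simp; norm_num
  unfold fFn'
  refine (norm_add_le _ _).trans ?_
  rw [norm_neg, norm_div, norm_mul, norm_mul, norm_mul, norm_pow, norm_div, norm_mul, norm_pow,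
    norm_pow, Complex.norm_real, Complex.norm_real, wderFn_norm, Complex.norm_natCast,
    Real.norm_eq_abs, Real.norm_eq_abs, abs_of_pos hpp]
  have ht : √t ^ 2 = t := Real.sq_sqrt h0.le
  calc _ ≤ (2 / √t) * 2 / ((√t / 2) * (√t / 28)) + 1 * (4 / √t) / (√t / 28) ^ 2 := by
        gcongr
        exact hψm m
    _ = 3360 / (√t ^ 2 * √t) := by field_simp; norm_num
    _ ≤ 4000 / (t * √t) := by rw [ht]; gcongr; norm_num

open Topology

/-- The leading coefficient of `√(w²-1)` at `0+`. -/
def alphaC : ℂ := √2 * (1 - Complex.I)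

lemma sqrt2_sq_C : ((√2 : ℝ) : ℂ) ^ 2 = 2 := by
  rw [← Complex.ofReal_pow, Real.sq_sqrt (by norm_num)]; simp

lemma alphaC_sq : alphaC ^ 2 = -4 * Complex.I := by
  unfold alphaC
  rw [mul_pow, sqrt2_sq_C]
  ring_nf
  rw [Complex.I_sq]; ring

lemma alphaC_re : alphaC.re = √2 := by simp [alphaC]

lemma alphaC_ne : alphaC ≠ 0 := by
  intro h
  have := alphaC_re
  rw [h] at this
  have h2 : 0 < √2 := by positivity
  simp at this; linarith

lemma w_zero : wFn 0 = 1 := by simp [wFn]; norm_num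

lemma ev_pos : ∀ᶠ t : ℝ in 𝓝[>] 0, 0 < t := self_mem_nhdsWithin

lemma w_lim : Tendsto wFn (𝓝[>] 0) (𝓝 1) := by
  have := (hasDerivAt_w 0).continuousAt.tendsto
  rw [w_zero] at this
  exact this.mono_left nhdsWithin_le_nhds

lemma sqrt_lim : Tendsto (fun t : ℝ => ((√t : ℝ) : ℂ)) (𝓝[>] 0) (𝓝 0) := by
  have : Continuous (fun t : ℝ => ((√t : ℝ) : ℂ)) := by fun_prop
  have h := this.tendsto 0
  simp only [Real.sqrt_zero, Complex.ofReal_zero] at h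
  exact h.mono_left nhdsWithin_le_nhds

lemma sqrt_sq_C {t : ℝ} (h : 0 < t) : ((√t : ℝ) : ℂ) ^ 2 = t := by
  rw [← Complex.ofReal_pow, Real.sq_sqrt h.le]

lemma sqrt_ne_C {t : ℝ} (h : 0 < t) : ((√t : ℝ) : ℂ) ≠ 0 := by
  exact_mod_cast (Real.sqrt_pos.2 h).ne'

lemma q_lim : Tendsto (fun t : ℝ => (wFn t ^ 2 - 1) / (t : ℂ)) (𝓝[>] 0) (𝓝 (-4 * Complex.I)) := by
  have hq : HasDerivAt (fun t => wFn t ^ 2 - 1) (2 * wFn 0 * wFn' 0) 0 := by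
    simpa using ((hasDerivAt_w 0).pow 2).sub_const 1
  have h := (hasDerivAt_iff_tendsto_slope.1 hq).mono_left
    (nhdsWithin_mono (0 : ℝ) (fun x (hx : x ∈ Set.Ioi (0 : ℝ)) => (ne_of_gt hx : x ≠ 0)))
  have e : 2 * wFn 0 * wFn' 0 = -4 * Complex.I := by
    rw [w_zero]; simp [wFn']; ring
  rw [e] at h
  refine h.congr (fun t => ?_)
  simp [slope_def_module, w_zero, div_eq_inv_mul]

lemma w1_lim : Tendsto (fun t : ℝ => (wFn t - 1) / ((√t : ℝ) : ℂ)) (𝓝[>] 0) (𝓝 0) := by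
  have h := (hasDerivAt_iff_tendsto_slope.1 (hasDerivAt_w 0)).mono_left
    (nhdsWithin_mono (0 : ℝ) (fun x (hx : x ∈ Set.Ioi (0 : ℝ)) => (ne_of_gt hx : x ≠ 0)))
  have h2 := h.mul sqrt_lim
  rw [mul_zero] at h2
  refine h2.congr' ?_
  filter_upwards [ev_pos] with t ht
  have := sqrt_sq_C ht
  have h3 := sqrt_ne_C ht
  have h4 : (t : ℂ) ≠ 0 := by exact_mod_cast ht.ne'
  simp only [slope_def_module, w_zero, sub_zero, Complex.real_smul, Complex.ofReal_inv]
  field_simp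
  rw [this, mul_comm]

lemma ev_le_pi : ∀ᶠ t : ℝ in 𝓝[>] 0, t ≤ π :=
  nhdsWithin_le_nhds ((eventually_lt_nhds Real.pi_pos).mono (fun _ h => h.le))

lemma s_lim : Tendsto (fun t : ℝ => sFn t / ((√t : ℝ) : ℂ)) (𝓝[>] 0) (𝓝 alphaC) := by
  rw [tendsto_iff_norm_sub_tendsto_zero]
  have h : Tendsto (fun t : ℝ => ‖(wFn t ^ 2 - 1) / (t : ℂ) - alphaC ^ 2‖) (𝓝[>] 0) (𝓝 0) := by
    rw [← tendsto_iff_norm_sub_tendsto_zero, alphaC_sq]; exact q_lim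
  refine squeeze_zero' (Eventually.of_forall fun _ => norm_nonneg _) ?_ h
  filter_upwards [ev_pos] with t ht
  have e : (wFn t ^ 2 - 1) / (t : ℂ) - alphaC ^ 2 =
      (sFn t / ((√t : ℝ) : ℂ) - alphaC) * (sFn t / ((√t : ℝ) : ℂ) + alphaC) := by
    rw [← sFn_sq, ← sqrt_sq_C ht]; ring
  rw [e, norm_mul]
  refine le_mul_of_one_le_right (norm_nonneg _) ?_
  refine le_trans ?_ (Complex.re_le_norm _)
  rw [Complex.add_re, alphaC_re, Complex.div_ofReal_re]
  have := div_nonneg (sFn_re_nonneg t) (Real.sqrt_nonneg t)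
  have : 1 ≤ √2 := Real.one_le_sqrt.2 (by norm_num)
  linarith

lemma s_lim0 : Tendsto sFn (𝓝[>] 0) (𝓝 0) := by
  have h := s_lim.mul sqrt_lim
  rw [mul_zero] at h
  refine h.congr' ?_
  filter_upwards [ev_pos] with t ht
  have h3 := sqrt_ne_C ht
  field_simp

lemma psi_lim : Tendsto psiFn (𝓝[>] 0) (𝓝 1) := by
  have h := w_lim.sub s_lim0
  rw [sub_zero] at h
  exact h

lemma psi1_lim : Tendsto (fun t : ℝ => (psiFn t - 1) / ((√t : ℝ) : ℂ)) (𝓝[>] 0) (𝓝 (-alphaC)) := by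
  have := w1_lim.sub s_lim
  rw [zero_sub] at this
  refine this.congr (fun t => ?_)
  rw [psi_eq]; ring

lemma phi_lim : Tendsto (fun t : ℝ => (1 - phiFn t) / √t) (𝓝[>] 0) (𝓝 (√2)) := by
  have h := s_lim.mul psi_lim
  have h2 := (Complex.continuous_re.tendsto _).comp h
  rw [mul_one, alphaC_re] at h2
  refine h2.congr (fun t => ?_)
  rw [one_sub_phi, ← Complex.div_ofReal_re]
  simp only [Function.comp]
  congr 1; ring

lemma phi_lim_C : Tendsto (fun t : ℝ => ((1 - phiFn t : ℝ) : ℂ) / ((√t : ℝ) : ℂ))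
    (𝓝[>] 0) (𝓝 ((√2 : ℝ) : ℂ)) := by
  have := (Complex.continuous_ofReal.tendsto _).comp phi_lim
  refine this.congr (fun t => ?_)
  simp [Function.comp]

lemma wder_lim : Tendsto wFn' (𝓝[>] 0) (𝓝 (-2 * Complex.I)) := by
  have : Continuous wFn' := by unfold wFn'; fun_prop
  have h := this.tendsto 0
  have e : wFn' 0 = -2 * Complex.I := by simp [wFn']
  rw [e] at h
  exact h.mono_left nhdsWithin_le_nhds

lemma phider_lim : Tendsto (fun t : ℝ => √t * phiFn' t) (𝓝[>] 0) (𝓝 (-(√2 / 2))) := by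
  have h := ((wder_lim.mul (psi_lim.pow 2)).div s_lim alphaC_ne)
  have h2 := ((Complex.continuous_re.tendsto _).comp h).neg
  have e : (-2 * Complex.I * 1 ^ 2 / alphaC) = ((√2 / 2 : ℝ) : ℂ) * (1 - Complex.I) := by
    rw [div_eq_iff alphaC_ne]
    unfold alphaC
    push_cast
    have h := sqrt2_sq_C
    have h3 := Complex.I_sq
    linear_combination (-(1 - Complex.I) ^ 2 / 2) * h - h3
  rw [e] at h2
  have e2 : (((√2 / 2 : ℝ) : ℂ) * (1 - Complex.I)).re = √2 / 2 := by
    rw [Complex.re_ofReal_mul]; simp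
  rw [e2] at h2
  refine h2.congr' ?_
  filter_upwards [ev_pos, ev_le_pi] with t ht hpi
  have h3 := sqrt_ne_C ht
  have h4 := s_ne ht hpi
  simp only [Function.comp, phiFn', Pi.div_apply]
  rw [mul_neg, ← Complex.re_ofReal_mul]
  congr 2
  field_simp

lemma norm_pow_sub_one_le {z : ℂ} (hz : ‖z‖ ≤ 1) (m : ℕ) : ‖z ^ m - 1‖ ≤ m * ‖z - 1‖ := by
  induction m with
  | zero => simp
  | succ m ih =>
    have : z ^ (m + 1) - 1 = z ^ m * (z - 1) + (z ^ m - 1) := by ring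
    rw [this]
    refine (norm_add_le _ _).trans ?_
    rw [norm_mul, norm_pow]
    have h := pow_le_one₀ (n := m) (norm_nonneg _) hz
    push_cast
    nlinarith [norm_nonneg (z - 1)]

lemma fder_lim (m : ℕ → ℕ) (t : ℕ → ℝ) (ht : Tendsto t atTop (𝓝[>] 0))
    (hm : Tendsto (fun k => m k * √(t k)) atTop (𝓝 0)) :
    Tendsto (fun k => ((t k * √(t k) : ℝ) : ℂ) * fFn' (m k) (t k)) atTop
      (𝓝 ((-(√2 / 4) : ℝ) : ℂ)) := by
  have hpsi : Tendsto (fun k => psiFn (t k) ^ m k) atTop (𝓝 1) := by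
    rw [tendsto_iff_norm_sub_tendsto_zero]
    have h := hm.mul ((psi1_lim.comp ht).norm)
    rw [zero_mul] at h
    refine squeeze_zero' (Eventually.of_forall fun _ => norm_nonneg _) ?_ h
    filter_upwards [ht.eventually ev_pos] with k hk
    refine (norm_pow_sub_one_le (psi_norm_le_one _) _).trans (le_of_eq ?_)
    simp only [Function.comp, norm_div, Complex.norm_real, Real.norm_eq_abs,
      abs_of_pos (Real.sqrt_pos.2 hk)]
    have := (Real.sqrt_pos.2 hk).ne'
    field_simp
  have hmC : Tendsto (fun k => (m k : ℂ) * ((√(t k) : ℝ) : ℂ)) atTop (𝓝 0) := by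
    have := (Complex.continuous_ofReal.tendsto _).comp hm
    simpa [Function.comp_def] using this
  have h2 : ((√2 : ℝ) : ℂ) ≠ 0 := sqrt_ne_C (by norm_num)
  have hC := (wder_lim.div (s_lim.mul phi_lim_C) (mul_ne_zero alphaC_ne h2)).comp ht
  have hB0 := phider_lim.div (phi_lim.pow 2) (by positivity)
  have hB := ((Complex.continuous_ofReal.tendsto _).comp hB0).comp ht
  have e : -(√2 / 2) / √2 ^ 2 = -(√2 / 4) := by
    rw [Real.sq_sqrt (by norm_num)]; ring
  rw [e] at hB
  have h := hpsi.mul ((hmC.mul hC).neg.add hB)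
  rw [zero_mul, neg_zero, zero_add, one_mul] at h
  refine h.congr' ?_
  filter_upwards [ht.eventually ev_pos, ht.eventually ev_le_pi] with k hk hpi
  have h3 := sqrt_ne_C hk
  have h4 := s_ne hk hpi
  have h5 : ((1 - phiFn (t k) : ℝ) : ℂ) ≠ 0 := by exact_mod_cast (phi_pos hk hpi).ne'
  have h6 := sqrt_sq_C hk
  unfold fFn'
  simp only [Function.comp, Pi.div_apply]
  rw [Complex.ofReal_mul (t k), ← h6]
  rw [Complex.ofReal_div, Complex.ofReal_pow, Complex.ofReal_div, Complex.ofReal_mul]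
  generalize ((1 - phiFn (t k) : ℝ) : ℂ) = P at *
  generalize ((√(t k) : ℝ) : ℂ) = R at *
  field_simp

open MeasureTheory

/-- The dominating function. -/
def dFn (s : ℝ) : ℝ := min s 2 / (s * √s)

lemma inv_sqrt_eq {s : ℝ} (hs : 0 < s) : 1 / √s = s ^ (-(1 / 2) : ℝ) := by
  rw [Real.rpow_neg hs.le, Real.sqrt_eq_rpow, one_div]

lemma inv_s_sqrt_eq {s : ℝ} (hs : 0 < s) : 1 / (s * √s) = s ^ (-(3 / 2) : ℝ) := by
  rw [Real.rpow_neg hs.le, Real.sqrt_eq_rpow, one_div]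
  congr 1
  nth_rewrite 1 [← Real.rpow_one s]
  rw [← Real.rpow_add hs]; norm_num

lemma inv_sqrt_integrable {b : ℝ} (hb : 0 ≤ b) :
    IntegrableOn (fun s : ℝ => 1 / √s) (Set.Ioc 0 b) := by
  have h := intervalIntegral.intervalIntegrable_rpow' (a := 0) (b := b) (r := -(1 / 2)) (by norm_num)
  rw [intervalIntegrable_iff_integrableOn_Ioc_of_le hb] at h
  exact h.congr_fun (fun s hs => (inv_sqrt_eq hs.1).symm) measurableSet_Ioc

lemma dFn_meas (s : Set ℝ) : AEStronglyMeasurable dFn (volume.restrict s) := by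
  have : Measurable dFn := by unfold dFn; fun_prop
  exact this.aestronglyMeasurable

lemma dFn_nonneg {s : ℝ} (hs : 0 < s) : 0 ≤ dFn s := by unfold dFn; positivity

lemma dFn_le_left {s : ℝ} (hs : 0 < s) : dFn s ≤ 1 / √s := by
  have := Real.sqrt_pos.2 hs
  calc dFn s ≤ s / (s * √s) := by unfold dFn; gcongr; exact min_le_left _ _
    _ = _ := by field_simp

lemma dFn_integrable : IntegrableOn dFn (Set.Ioi 0) := by
  rw [← Set.Ioc_union_Ioi_eq_Ioi (zero_le_one' ℝ)]
  refine IntegrableOn.union ?_ ?_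
  · refine (inv_sqrt_integrable zero_le_one).mono' (dFn_meas _) ?_
    refine (ae_restrict_iff' measurableSet_Ioc).2 (Eventually.of_forall fun s hs => ?_)
    rw [Real.norm_eq_abs, abs_of_nonneg (dFn_nonneg hs.1)]
    exact dFn_le_left hs.1
  · have h := (integrableOn_Ioi_rpow_of_lt (a := -(3 / 2)) (by norm_num) zero_lt_one).const_mul 2
    refine Integrable.mono' h (dFn_meas _) ?_
    refine (ae_restrict_iff' measurableSet_Ioi).2 (Eventually.of_forall fun s hs => ?_)
    have hs0 : 0 < s := lt_trans one_pos hs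
    rw [Real.norm_eq_abs, abs_of_nonneg (dFn_nonneg hs0), ← inv_s_sqrt_eq hs0]
    have := Real.sqrt_pos.2 hs0
    calc dFn s ≤ 2 / (s * √s) := by unfold dFn; gcongr; exact min_le_right _ _
      _ = _ := by ring

/-- The oscillating primitive. -/
def hFn (ε s : ℝ) : ℂ := (Real.sin s : ℂ) + (ε * (1 - Real.cos s) : ℝ) * Complex.I

lemma hFn_re (ε s : ℝ) : (hFn ε s).re = Real.sin s := by
  unfold hFn
  rw [Complex.add_re, Complex.re_ofReal_mul]; simp [-Complex.ofReal_sin]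

lemma hFn_im (ε s : ℝ) : (hFn ε s).im = ε * (1 - Real.cos s) := by
  unfold hFn
  rw [Complex.add_im, Complex.im_ofReal_mul]; simp [-Complex.ofReal_sin]

lemma hFn_norm {ε s : ℝ} (hε : |ε| = 1) (hs : 0 ≤ s) : ‖hFn ε s‖ ≤ min s 2 := by
  have h2 : ‖hFn ε s‖ ^ 2 = 2 * (1 - Real.cos s) := by
    rw [← Complex.normSq_eq_norm_sq, Complex.normSq_apply, hFn_re, hFn_im]
    have : ε ^ 2 = 1 := by rw [← sq_abs, hε]; norm_num
    have h3 := Real.sin_sq_add_cos_sq s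
    linear_combination (1 - Real.cos s) ^ 2 * this + h3
  have h3 := Real.one_sub_sq_div_two_le_cos (x := s)
  have h4 := Real.neg_one_le_cos s
  apply le_min
  · apply le_of_sq_le_sq _ hs
    rw [h2]; linarith
  · apply le_of_sq_le_sq _ (by norm_num)
    rw [h2]; linarith

lemma hFn_deriv {ε : ℝ} (hε : |ε| = 1) (N t : ℝ) :
    HasDerivAt (fun t => hFn ε (N * t)) (N * Complex.exp (Complex.I * t * (ε * N))) t := by
  have hN : HasDerivAt (fun t : ℝ => N * t) N t := by simpa using (hasDerivAt_id t).const_mul N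
  have h1 := hN.sin.ofReal_comp
  have h2 := (((hN.cos.const_sub 1).const_mul ε).ofReal_comp).mul_const Complex.I
  refine (h1.add h2).congr_deriv ?_
  have e : Complex.I * t * (ε * N) = ((ε * (N * t) : ℝ) : ℂ) * Complex.I := by push_cast; ring
  rw [e, Complex.exp_mul_I, ← Complex.ofReal_cos, ← Complex.ofReal_sin]
  rcases (abs_eq (zero_le_one' ℝ)).1 hε with h | h <;> subst h
  · push_cast; ring_nf
  · rw [neg_one_mul (N * t), Real.cos_neg, Real.sin_neg]; push_cast; ring_nf

lemma hFn_cont (ε : ℝ) : Continuous (hFn ε) := by unfold hFn; fun_prop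

lemma f_contOn (m : ℕ) : ContinuousOn (fFn m) (Set.Ioc 0 π) :=
  fun t ht => (hasDerivAt_f m ht.1 ht.2).continuousAt.continuousWithinAt

lemma fder_contOn (m : ℕ) : ContinuousOn (fFn' m) (Set.Ioc 0 π) := by
  have hw : ContinuousOn wFn' (Set.Ioc 0 π) := by
    have : Continuous wFn' := by unfold wFn'; fun_prop
    exact this.continuousOn
  have hs : ContinuousOn sFn (Set.Ioc 0 π) :=
    fun t ht => (hasDerivAt_s ht.1 ht.2).continuousAt.continuousWithinAt
  have hp : ContinuousOn psiFn (Set.Ioc 0 π) :=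
    fun t ht => (hasDerivAt_psi ht.1 ht.2).continuousAt.continuousWithinAt
  have hph : ContinuousOn phiFn (Set.Ioc 0 π) :=
    fun t ht => (hasDerivAt_phi ht.1 ht.2).continuousAt.continuousWithinAt
  have hph' : ContinuousOn phiFn' (Set.Ioc 0 π) := by
    unfold phiFn'
    exact (Complex.continuous_re.comp_continuousOn
      ((hw.mul (hp.pow 2)).div hs (fun t ht => s_ne ht.1 ht.2))).neg
  have h1 : ContinuousOn (fun t => ((1 - phiFn t : ℝ) : ℂ)) (Set.Ioc 0 π) :=
    Complex.continuous_ofReal.comp_continuousOn (continuousOn_const.sub hph)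
  have h1n : ∀ t ∈ Set.Ioc 0 π, ((1 - phiFn t : ℝ) : ℂ) ≠ 0 := fun t ht => by
    exact_mod_cast (phi_pos ht.1 ht.2).ne'
  unfold fFn'
  refine ContinuousOn.add (ContinuousOn.neg (ContinuousOn.div ?_ (hs.mul h1) ?_))
    (ContinuousOn.div ?_ (h1.pow 2) ?_)
  · exact (continuousOn_const.mul (hp.pow m)).mul hw
  · exact fun t ht => mul_ne_zero (s_ne ht.1 ht.2) (h1n t ht)
  · exact (hp.pow m).mul (Complex.continuous_ofReal.comp_continuousOn hph')
  · exact fun t ht => pow_ne_zero _ (h1n t ht)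

lemma ef_integrable (m : ℕ) (g : ℝ → ℂ) (hg : Continuous g) (hb : ∀ t, ‖g t‖ ≤ 1) :
    IntegrableOn (fun t => g t * fFn m t) (Set.Ioc 0 π) := by
  refine Integrable.mono' ((inv_sqrt_integrable Real.pi_pos.le).const_mul 28)
    ((hg.continuousOn.mul (f_contOn m)).aestronglyMeasurable measurableSet_Ioc) ?_
  refine (ae_restrict_iff' measurableSet_Ioc).2 (Eventually.of_forall fun t ht => ?_)
  rw [norm_mul]
  have := f_bound m ht.1 ht.2
  calc _ ≤ 1 * (28 / √t) := by gcongr; exact hb t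
    _ = _ := by ring

lemma dFn_scale {N t : ℝ} (hN : 0 < N) (ht : 0 < t) :
    min (N * t) 2 * (4000 / (t * √t)) = 4000 * (N * √N) * dFn (N * t) := by
  unfold dFn
  rw [Real.sqrt_mul hN.le]
  have := Real.sqrt_pos.2 ht
  have := Real.sqrt_pos.2 hN
  field_simp

lemma hfder_bound (m : ℕ) {ε N t : ℝ} (hε : |ε| = 1) (hN : 0 < N) (h0 : 0 < t) (hpi : t ≤ π) :
    ‖hFn ε (N * t) * fFn' m t‖ ≤ 4000 * (N * √N) * dFn (N * t) := by
  rw [← dFn_scale hN h0, norm_mul]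
  gcongr
  · exact hFn_norm hε (by positivity)
  · exact fder_bound m h0 hpi

lemma hfder_integrable (m : ℕ) {ε N : ℝ} (hε : |ε| = 1) (hN : 0 < N) :
    IntegrableOn (fun t => hFn ε (N * t) * fFn' m t) (Set.Ioc 0 π) := by
  have hd : IntegrableOn (fun t => dFn (N * t)) (Set.Ioi 0) := by
    rw [integrableOn_Ioi_comp_mul_left_iff _ _ hN, mul_zero]
    exact dFn_integrable
  refine Integrable.mono' ((hd.mono_set Set.Ioc_subset_Ioi_self).const_mul (4000 * (N * √N)))
    ((((hFn_cont ε).comp (continuous_const.mul continuous_id)).continuousOn.mul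
      (fder_contOn m)).aestronglyMeasurable measurableSet_Ioc) ?_
  refine (ae_restrict_iff' measurableSet_Ioc).2 (Eventually.of_forall fun t ht => ?_)
  exact hfder_bound m hε hN ht.1 ht.2

lemma exp_norm (a b t : ℝ) : ‖Complex.exp (Complex.I * t * (a * b))‖ = 1 := by
  have e : Complex.I * t * (a * b) = ((t * a * b : ℝ) : ℂ) * Complex.I := by push_cast; ring
  rw [e, Complex.norm_exp_ofReal_mul_I]

lemma ibp (m : ℕ) {ε N : ℝ} (hε : |ε| = 1) (hN : 0 < N) :
    (N : ℂ) * ∫ t in (0 : ℝ)..π, Complex.exp (Complex.I * t * (ε * N)) * fFn m t =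
      hFn ε (N * π) * fFn m π - ∫ t in (0 : ℝ)..π, hFn ε (N * t) * fFn' m t := by
  have i1 : IntervalIntegrable
      (fun t : ℝ => Complex.exp (Complex.I * t * (ε * N)) * fFn m t) volume 0 π := by
    rw [intervalIntegrable_iff_integrableOn_Ioc_of_le Real.pi_pos.le]
    exact ef_integrable m _ (by fun_prop) (fun t => (exp_norm _ _ _).le)
  have i2 : IntervalIntegrable (fun t : ℝ => hFn ε (N * t) * fFn' m t) volume 0 π := by
    rw [intervalIntegrable_iff_integrableOn_Ioc_of_le Real.pi_pos.le]
    exact hfder_integrable m hε hN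
  have key := intervalIntegral.integral_eq_sub_of_hasDerivAt_of_tendsto Real.pi_pos
    (f := fun t => hFn ε (N * t) * fFn m t)
    (f' := fun t => (N : ℂ) * (Complex.exp (Complex.I * t * (ε * N)) * fFn m t)
      + hFn ε (N * t) * fFn' m t) (fa := 0) (fb := hFn ε (N * π) * fFn m π)
    (fun t ht => ((hFn_deriv hε N t).mul (hasDerivAt_f m ht.1 ht.2.le)).congr_deriv (by ring))
    ((i1.const_mul _).add i2) ?_ ?_
  · rw [intervalIntegral.integral_add (i1.const_mul _) i2, intervalIntegral.integral_const_mul,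
      sub_zero] at key
    rw [← key]; ring
  · have h : Tendsto (fun t : ℝ => N * 28 * √t) (𝓝[>] 0) (𝓝 0) := by
      have : Continuous (fun t : ℝ => N * 28 * √t) := by fun_prop
      have h := this.tendsto 0
      simp only [Real.sqrt_zero, mul_zero] at h
      exact h.mono_left nhdsWithin_le_nhds
    refine squeeze_zero_norm' ?_ h
    filter_upwards [ev_pos, ev_le_pi] with t ht hpi
    rw [norm_mul]
    have h1 := (hFn_norm hε (by positivity : 0 ≤ N * t)).trans (min_le_left _ _)
    have h2 := f_bound m ht hpi
    have hs := Real.sqrt_pos.2 ht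
    calc _ ≤ (N * t) * (28 / √t) := by gcongr
      _ = N * 28 * (t / √t) := by ring
      _ = _ := by rw [Real.div_sqrt]
  · exact (((hFn_deriv hε N π).mul
      (hasDerivAt_f m Real.pi_pos le_rfl)).continuousAt.tendsto).mono_left nhdsWithin_le_nhds

/-- The limiting integral. -/
def limL : ℝ := ∫ s in Set.Ioi (0 : ℝ), Real.sin s / (s * √s)

lemma sin_integrable : IntegrableOn (fun s : ℝ => Real.sin s / (s * √s)) (Set.Ioi 0) := by
  refine Integrable.mono' dFn_integrable
    (Measurable.aestronglyMeasurable (by fun_prop)) ?_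
  refine (ae_restrict_iff' measurableSet_Ioi).2 (Eventually.of_forall fun s hs => ?_)
  have hs0 : 0 < s := hs
  rw [Real.norm_eq_abs, abs_div, abs_of_pos (mul_pos hs0 (Real.sqrt_pos.2 hs0))]
  have h := hFn_norm (ε := 1) (by simp) hs0.le
  have h2 := (Complex.abs_re_le_norm (hFn 1 s)).trans h
  rw [hFn_re] at h2
  unfold dFn
  gcongr

lemma cos_bounds {s : ℝ} : 0 ≤ 1 - Real.cos s ∧ 1 - Real.cos s ≤ s ^ 2 / 2 ∧ 1 - Real.cos s ≤ 2 :=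
  ⟨by linarith [Real.cos_le_one s], by linarith [Real.one_sub_sq_div_two_le_cos (x := s)],
    by linarith [Real.neg_one_le_cos s]⟩

lemma cos_integrable : IntegrableOn (fun s : ℝ => (1 - Real.cos s) / (s ^ 2 * √s)) (Set.Ioi 0) := by
  refine Integrable.mono' (dFn_integrable.const_mul 2)
    (Measurable.aestronglyMeasurable (by fun_prop)) ?_
  refine (ae_restrict_iff' measurableSet_Ioi).2 (Eventually.of_forall fun s hs => ?_)
  have hs0 : 0 < s := hs
  have hq := Real.sqrt_pos.2 hs0
  obtain ⟨h1, h2, h3⟩ := cos_bounds (s := s)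
  rw [Real.norm_eq_abs, abs_of_nonneg (by positivity)]
  unfold dFn
  have key : (1 - Real.cos s) / s ≤ 2 * min s 2 := by
    rw [div_le_iff₀ hs0]
    rcases min_cases s 2 with ⟨h, _⟩ | ⟨h, hlt⟩ <;> rw [h] <;> nlinarith
  calc _ = ((1 - Real.cos s) / s) / (s * √s) := by field_simp
    _ ≤ (2 * min s 2) / (s * √s) := by gcongr
    _ = _ := by ring

lemma limL_pos : 0 < limL := by
  have hder : ∀ s ∈ Set.Ioi (0 : ℝ), HasDerivAt (fun s => (1 - Real.cos s) / (s * √s))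
      (Real.sin s / (s * √s) - 3 / 2 * ((1 - Real.cos s) / (s ^ 2 * √s))) s := by
    intro s hs
    have hs0 : 0 < s := hs
    have hq := Real.sqrt_pos.2 hs0
    have h1 := ((Real.hasDerivAt_cos s).const_sub 1).div
      ((hasDerivAt_id s).mul (Real.hasDerivAt_sqrt hs0.ne')) (mul_pos hs0 hq).ne'
    refine h1.congr_deriv ?_
    have e : √s ^ 2 = s := Real.sq_sqrt hs0.le
    simp only [id, Pi.mul_apply]
    rw [div_sub' (by positivity), div_eq_div_iff (by positivity) (by positivity)]
    field_simp
    rw [e]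
    ring
  have hderint := sin_integrable.sub (cos_integrable.const_mul (3 / 2))
  have hcont : ContinuousWithinAt (fun s : ℝ => (1 - Real.cos s) / (s * √s)) (Set.Ici 0) 0 := by
    unfold ContinuousWithinAt
    have e0 : (1 - Real.cos 0) / (0 * √0) = 0 := by simp
    change Tendsto _ _ (𝓝 ((1 - Real.cos 0) / (0 * √0)))
    rw [e0]
    have h : Tendsto (fun t : ℝ => √t / 2 ) (𝓝[≥] 0) (𝓝 0) := by
      have : Continuous (fun t : ℝ => √t / 2) := by fun_prop
      have h := this.tendsto 0
      simp only [Real.sqrt_zero, zero_div] at h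
      exact h.mono_left nhdsWithin_le_nhds
    refine squeeze_zero' ?_ ?_ h
    · filter_upwards [self_mem_nhdsWithin] with s hs
      exact div_nonneg cos_bounds.1 (mul_nonneg hs (Real.sqrt_nonneg _))
    · filter_upwards [self_mem_nhdsWithin] with s hs
      rcases (show (0 : ℝ) ≤ s from hs).eq_or_lt with h | h
      · rw [← h]; simp
      · have hq := Real.sqrt_pos.2 h
        calc _ ≤ (s ^ 2 / 2) / (s * √s) := by gcongr; exact cos_bounds.2.1
          _ = (s / √s) / 2 := by field_simp
          _ = _ := by rw [Real.div_sqrt]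
  have htop : Tendsto (fun s : ℝ => (1 - Real.cos s) / (s * √s)) atTop (𝓝 0) := by
    have h : Tendsto (fun s : ℝ => 2 / s) atTop (𝓝 0) := tendsto_const_nhds.div_atTop tendsto_id
    refine squeeze_zero' ?_ ?_ h
    · filter_upwards [eventually_ge_atTop 1] with s hs
      exact div_nonneg cos_bounds.1 (mul_nonneg (by linarith) (Real.sqrt_nonneg _))
    · filter_upwards [eventually_ge_atTop 1] with s hs
      have : 1 ≤ √s := Real.one_le_sqrt.2 hs
      have hs0 : 0 < s := by linarith
      gcongr
      · exact cos_bounds.2.2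
      · nlinarith
  have key := integral_Ioi_of_hasDerivAt_of_tendsto hcont hder hderint htop
  have hval : limL = 3 / 2 * ∫ s in Set.Ioi (0 : ℝ), (1 - Real.cos s) / (s ^ 2 * √s) := by
    rw [← integral_const_mul]
    have h2 := integral_sub sin_integrable (cos_integrable.const_mul (3 / 2))
    have h3 : (0 : ℝ) - (1 - Real.cos 0) / (0 * √0) = 0 := by simp
    unfold limL
    rw [h3] at key
    linarith [h2.symm.trans key]
  rw [hval]
  refine mul_pos (by norm_num) ?_
  rw [setIntegral_pos_iff_support_of_nonneg_ae ?_ cos_integrable]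
  · have hsub : Set.Ioo (0 : ℝ) π ⊆
        Function.support (fun s : ℝ => (1 - Real.cos s) / (s ^ 2 * √s)) ∩ Set.Ioi 0 := by
      intro s hs
      refine ⟨?_, hs.1⟩
      have h1 : Real.cos s < 1 := by
        have := Real.cos_lt_cos_of_nonneg_of_le_pi le_rfl hs.2.le hs.1
        simpa using this
      have h2 := Real.sqrt_pos.2 hs.1
      have h3 := hs.1
      have : 0 < (1 - Real.cos s) / (s ^ 2 * √s) := div_pos (by linarith) (by positivity)
      exact this.ne'
    refine lt_of_lt_of_le ?_ (measure_mono hsub)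
    simp [Real.pi_pos]
  · refine (ae_restrict_iff' measurableSet_Ioi).2 (Eventually.of_forall fun s hs => ?_)
    exact div_nonneg cos_bounds.1 (by positivity)

lemma re_hf_bound (m : ℕ) {ε N s : ℝ} (hε : |ε| = 1) (hN : 0 < N) (h0 : 0 < s) (hpi : s ≤ N * π) :
    |1 / (N * √N) * (hFn ε s * fFn' m (s / N)).re| ≤ 4000 * dFn s := by
  have h := hfder_bound m hε hN (t := s / N) (by positivity) (by rw [div_le_iff₀ hN]; linarith)
  rw [mul_div_cancel₀ _ hN.ne'] at h
  have h2 := (Complex.abs_re_le_norm _).trans h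
  have hq := Real.sqrt_pos.2 hN
  rw [abs_mul, abs_of_pos (by positivity : 0 < 1 / (N * √N))]
  calc _ ≤ 1 / (N * √N) * (4000 * (N * √N) * dFn s) := by gcongr
    _ = _ := by field_simp

/-- The rescaled integrand. -/
def gFn (m : ℕ) (ε N : ℝ) : ℝ → ℝ :=
  Set.indicator (Set.Ioc 0 (N * π)) (fun s => 1 / (N * √N) * (hFn ε s * fFn' m (s / N)).re)

lemma gFn_integral (m : ℕ) {ε N : ℝ} (hε : |ε| = 1) (hN : 0 < N) :
    ∫ s in Set.Ioi (0 : ℝ), gFn m ε N s =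
      1 / √N * (∫ t in (0 : ℝ)..π, hFn ε (N * t) * fFn' m t).re := by
  have i2 : IntervalIntegrable (fun t : ℝ => hFn ε (N * t) * fFn' m t) volume 0 π := by
    rw [intervalIntegrable_iff_integrableOn_Ioc_of_le Real.pi_pos.le]
    exact hfder_integrable m hε hN
  have e1 := Complex.reCLM.intervalIntegral_comp_comm i2
  simp only [Complex.reCLM_apply] at e1
  rw [← e1]
  have e2 := intervalIntegral.integral_comp_mul_left (a := 0) (b := π)
    (fun s => (hFn ε s * fFn' m (s / N)).re) hN.ne'
  simp only [mul_div_cancel_left₀ _ hN.ne', mul_zero, smul_eq_mul] at e2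
  rw [e2]
  unfold gFn
  rw [setIntegral_indicator measurableSet_Ioc,
    Set.inter_eq_right.2 Set.Ioc_subset_Ioi_self, integral_const_mul,
    intervalIntegral.integral_of_le (by positivity)]
  have hq := Real.sqrt_pos.2 hN
  field_simp

lemma gFn_meas (m : ℕ) {ε N : ℝ} (hN : 0 < N) :
    AEStronglyMeasurable (gFn m ε N) (volume.restrict (Set.Ioi 0)) := by
  apply AEStronglyMeasurable.restrict
  unfold gFn
  rw [aestronglyMeasurable_indicator_iff measurableSet_Ioc]
  refine ContinuousOn.aestronglyMeasurable ?_ measurableSet_Ioc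
  refine continuousOn_const.mul (Complex.continuous_re.comp_continuousOn
    ((hFn_cont ε).continuousOn.mul ((fder_contOn m).comp (by fun_prop) ?_)))
  intro s hs
  exact ⟨div_pos hs.1 hN, by rw [div_le_iff₀ hN]; linarith [hs.2]⟩

lemma gFn_lim (m : ℕ → ℕ) (ε N : ℕ → ℝ) (hε : ∀ k, |ε k| = 1) (hN : Tendsto N atTop atTop)
    (hm : Tendsto (fun k => (m k : ℝ) ^ 2 / N k) atTop (𝓝 0)) {s : ℝ} (hs : 0 < s) :
    Tendsto (fun k => gFn (m k) (ε k) (N k) s) atTop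
      (𝓝 (-(√2 / 4) * (Real.sin s / (s * √s)))) := by
  have ht : Tendsto (fun k => s / N k) atTop (𝓝[>] 0) := by
    refine tendsto_nhdsWithin_iff.2 ⟨tendsto_const_nhds.div_atTop hN, ?_⟩
    filter_upwards [hN.eventually_gt_atTop 0] with k hk
    exact div_pos hs hk
  have hmt : Tendsto (fun k => m k * √(s / N k)) atTop (𝓝 0) := by
    have h := (hm.mul_const s).sqrt
    rw [zero_mul, Real.sqrt_zero] at h
    refine h.congr (fun k => ?_)
    rw [show (m k : ℝ) ^ 2 / N k * s = (m k : ℝ) ^ 2 * (s / N k) by ring,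
      Real.sqrt_mul (by positivity), Real.sqrt_sq (by positivity)]
  have h := fder_lim m _ ht hmt
  have hre := (Complex.continuous_re.tendsto _).comp h
  have him := (Complex.continuous_im.tendsto _).comp h
  rw [Complex.ofReal_re] at hre
  rw [Complex.ofReal_im] at him
  have h3 : Tendsto (fun k => ε k * (1 - Real.cos s) *
      (((s / N k * √(s / N k) : ℝ) : ℂ) * fFn' (m k) (s / N k)).im) atTop (𝓝 0) := by
    have h5 := him.abs.const_mul 2
    rw [abs_zero, mul_zero] at h5
    refine squeeze_zero_norm (fun k => ?_) h5
    rw [Real.norm_eq_abs, abs_mul, abs_mul, hε, one_mul, abs_of_nonneg cos_bounds.1]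
    exact mul_le_mul_of_nonneg_right cos_bounds.2.2 (abs_nonneg _)
  have h4 := ((hre.const_mul (Real.sin s)).sub h3).const_mul (1 / (s * √s))
  have e : 1 / (s * √s) * (Real.sin s * -(√2 / 4) - 0) = -(√2 / 4) * (Real.sin s / (s * √s)) := by
    ring
  rw [e] at h4
  refine h4.congr' ?_
  filter_upwards [hN.eventually_gt_atTop 0, hN.eventually_ge_atTop s] with k hk hks
  have hmem : s ∈ Set.Ioc 0 (N k * π) :=
    ⟨hs, by nlinarith [Real.pi_gt_three]⟩
  unfold gFn
  rw [Set.indicator_of_mem hmem]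
  simp only [Function.comp]
  rw [Complex.re_ofReal_mul, Complex.im_ofReal_mul, Complex.mul_re, hFn_re, hFn_im,
    Real.sqrt_div hs.le]
  have hq := Real.sqrt_pos.2 hs
  have hq2 := Real.sqrt_pos.2 hk
  field_simp

lemma half_lim (m : ℕ → ℕ) (ε N : ℕ → ℝ) (hε : ∀ k, |ε k| = 1) (hN : Tendsto N atTop atTop)
    (hm : Tendsto (fun k => (m k : ℝ) ^ 2 / N k) atTop (𝓝 0)) :
    Tendsto (fun k => √(N k) * (∫ t in (0 : ℝ)..π,
        Complex.exp (Complex.I * t * (ε k * N k)) * fFn (m k) t).re) atTop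
      (𝓝 (√2 / 4 * limL)) := by
  have h1 : Tendsto (fun k => ∫ s in Set.Ioi (0 : ℝ), gFn (m k) (ε k) (N k) s) atTop
      (𝓝 (∫ s in Set.Ioi (0 : ℝ), -(√2 / 4) * (Real.sin s / (s * √s)))) := by
    refine tendsto_integral_filter_of_dominated_convergence (fun s => 4000 * dFn s) ?_ ?_
      (dFn_integrable.const_mul 4000) ?_
    · filter_upwards [hN.eventually_gt_atTop 0] with k hk
      exact gFn_meas _ hk
    · filter_upwards [hN.eventually_gt_atTop 0] with k hk
      refine (ae_restrict_iff' measurableSet_Ioi).2 (Eventually.of_forall fun s hs => ?_)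
      have hs0 : 0 < s := hs
      unfold gFn
      by_cases hmem : s ∈ Set.Ioc 0 (N k * π)
      · rw [Set.indicator_of_mem hmem]
        exact re_hf_bound _ (hε k) hk hmem.1 hmem.2
      · rw [Set.indicator_of_notMem hmem, norm_zero]
        exact mul_nonneg (by norm_num) (dFn_nonneg hs0)
    · refine (ae_restrict_iff' measurableSet_Ioi).2 (Eventually.of_forall fun s hs => ?_)
      exact gFn_lim m ε N hε hN hm hs
  rw [integral_const_mul] at h1
  have h2 : Tendsto (fun k => 1 / √(N k) * (hFn (ε k) (N k * π) * fFn (m k) π).re) atTop (𝓝 0) := by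
    have hb : Tendsto (fun k => 1 / √(N k) * (2 * (28 / √π))) atTop (𝓝 0) := by
      have : Tendsto (fun k => 1 / √(N k)) atTop (𝓝 0) :=
        tendsto_const_nhds.div_atTop (Real.tendsto_sqrt_atTop.comp hN)
      simpa using this.mul_const (2 * (28 / √π))
    refine squeeze_zero_norm' ?_ hb
    filter_upwards [hN.eventually_gt_atTop 0] with k hk
    have hf := f_bound (m k) Real.pi_pos le_rfl
    have hh := (hFn_norm (hε k) (by positivity : 0 ≤ N k * π)).trans (min_le_right _ _)
    rw [Real.norm_eq_abs, abs_mul, abs_of_nonneg (by positivity : 0 ≤ 1 / √(N k))]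
    gcongr
    refine (Complex.abs_re_le_norm _).trans ?_
    rw [norm_mul]
    gcongr
  have h3 := h2.sub h1
  have e : 0 - -(√2 / 4) * ∫ s in Set.Ioi (0 : ℝ), (Real.sin s / (s * √s)) = √2 / 4 * limL := by
    unfold limL; ring
  rw [e] at h3
  refine h3.congr' ?_
  filter_upwards [hN.eventually_gt_atTop 0] with k hk
  rw [gFn_integral _ (hε k) hk, ← mul_sub, ← Complex.sub_re, ← ibp _ (hε k) hk,
    Complex.re_ofReal_mul]
  have hq := Real.sqrt_pos.2 hk
  have e : N k = √(N k) ^ 2 := (Real.sq_sqrt hk.le).symm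
  rw [← mul_assoc]
  congr 1
  nth_rewrite 2 [e]
  field_simp

open ComplexConjugate

lemma w_neg (t : ℝ) : wFn (-t) = conj (wFn t) := by
  unfold wFn
  simp only [map_sub, map_mul, ← Complex.exp_conj, Complex.conj_ofNat]
  simp

lemma s_neg {t : ℝ} (h0 : 0 < t) (hpi : t ≤ π) : sFn (-t) = conj (sFn t) := by
  unfold sFn
  have h := Complex.cpow_conj (wFn t ^ 2 - 1) ((1 : ℂ) / 2)
    (Complex.slitPlane_arg_ne_pi (q_slit h0 hpi))
  have e : conj ((1 : ℂ) / 2) = 1 / 2 := by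
    rw [map_div₀, map_one, Complex.conj_ofNat]
  rw [e] at h
  rw [h, w_neg, Complex.conj_conj]
  simp

lemma f_neg (m : ℕ) {t : ℝ} (h0 : 0 < t) (hpi : t ≤ π) : fFn m (-t) = conj (fFn m t) := by
  have hp : psiFn (-t) = conj (psiFn t) := by
    rw [psi_eq, psi_eq, w_neg, s_neg h0 hpi, map_sub]
  have hph : phiFn (-t) = phiFn t := by
    unfold phiFn
    rw [hp, w_neg, ← map_mul, Complex.conj_re]
  unfold fFn
  rw [hp, hph]
  simp

lemma full_eq (m : ℕ) (ε N : ℝ) :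
    ∫ t in (-π)..π, Complex.exp (Complex.I * t * (ε * N)) * fFn m t =
      ((2 * (∫ t in (0 : ℝ)..π, Complex.exp (Complex.I * t * (ε * N)) * fFn m t).re : ℝ) : ℂ) := by
  set F : ℝ → ℂ := fun t => Complex.exp (Complex.I * t * (ε * N)) * fFn m t with hF
  have i1 : IntervalIntegrable F volume 0 π := by
    rw [intervalIntegrable_iff_integrableOn_Ioc_of_le Real.pi_pos.le]
    exact ef_integrable m _ (by fun_prop) (fun t => (exp_norm _ _ _).le)
  have hneg : ∀ t ∈ Set.Ioc 0 π, conj (F t) = F (-t) := by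
    intro t ht
    simp only [hF]
    rw [map_mul, f_neg m ht.1 ht.2, ← Complex.exp_conj]
    simp
  have hneg' : Set.EqOn (fun t => conj (F t)) (fun t => F (-t)) (Set.Ioc 0 π) := hneg
  have ic : IntervalIntegrable (fun t => conj (F t)) volume 0 π := by
    rw [intervalIntegrable_iff_integrableOn_Ioc_of_le Real.pi_pos.le] at i1 ⊢
    exact (Complex.conjCLE : ℂ →L[ℝ] ℂ).integrable_comp i1
  have i3 : IntervalIntegrable (fun t => F (-t)) volume 0 π := by
    rw [intervalIntegrable_iff_integrableOn_Ioc_of_le Real.pi_pos.le] at ic ⊢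
    exact ic.congr_fun hneg' measurableSet_Ioc
  have i2 : IntervalIntegrable F volume (-π) 0 := by
    have := (IntervalIntegrable.iff_comp_neg (f := F) (a := -π) (b := 0)).2
      (by simpa using i3.symm)
    exact this
  have e1 : ∫ t in (-π)..0, F t = conj (∫ t in (0 : ℝ)..π, F t) := by
    have h := intervalIntegral.integral_comp_neg (a := 0) (b := π) F
    rw [neg_zero] at h
    rw [← h, intervalIntegral.integral_of_le Real.pi_pos.le,
      intervalIntegral.integral_of_le Real.pi_pos.le, ← integral_conj]
    exact setIntegral_congr_fun measurableSet_Ioc (fun t ht => (hneg t ht).symm)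
  rw [← intervalIntegral.integral_add_adjacent_intervals i2 i1, e1, add_comm, Complex.add_conj]

/-- Along any sequence `(y₁(k), y₂(k))` with `|y₁| → ∞` and `y₁/y₂² → ±∞`
(equivalently `y₂²/|y₁| → 0`, which in particular allows `y₂` bounded), the
renormalized Fourier integral of the Green function,
`√|y₁| ∫ e^{it(y₁-z)} ψ(t)^{|y₂|}/(1-φ(t)) dt`, converges to a nonzero constant. -/
theorem renormalized_green_tendsto_horizontal (z : ℤ)
    (y₁ y₂ : ℕ → ℤ)
    (h₁ : Tendsto (fun k => |y₁ k|) atTop atTop)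
    (hratio : Tendsto (fun k => (y₂ k : ℝ) ^ 2 / |(y₁ k : ℝ)|) atTop (nhds 0)) :
    ∃ C : ℂ, C ≠ 0 ∧
      Tendsto (fun k =>
          (Real.sqrt |(y₁ k : ℝ)| : ℂ) * ∫ t in (-Real.pi)..Real.pi,
            Complex.exp (Complex.I * t * ((y₁ k : ℂ) - (z : ℂ))) *
              psiFn t ^ (y₂ k).natAbs / (1 - (phiFn t : ℂ)))
        atTop (nhds C) := by
  have hL := limL_pos
  refine ⟨((√2 / 2 * limL : ℝ) : ℂ), by
    have : 0 < √2 / 2 * limL := by positivity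
    exact_mod_cast this.ne', ?_⟩
  set n : ℕ → ℝ := fun k => (y₁ k : ℝ) - z with hn
  set N : ℕ → ℝ := fun k => |n k| with hNd
  set ε : ℕ → ℝ := fun k => if 0 ≤ n k then 1 else -1 with hεd
  have hε : ∀ k, |ε k| = 1 := by
    intro k; simp only [hεd]; split_ifs <;> simp
  have hεN : ∀ k, ε k * N k = n k := by
    intro k; simp only [hεd, hNd]; split_ifs with h
    · rw [abs_of_nonneg h, one_mul]
    · rw [abs_of_neg (not_le.1 h)]; ring
  have hy : Tendsto (fun k => |(y₁ k : ℝ)|) atTop atTop := by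
    have := tendsto_intCast_atTop_atTop (R := ℝ) |>.comp h₁
    refine this.congr (fun k => ?_)
    simp
  have hN : Tendsto N atTop atTop := by
    refine tendsto_atTop_mono (fun k => ?_) (tendsto_atTop_add_const_right _ (-|(z : ℝ)|) hy)
    have := abs_sub_abs_le_abs_sub (y₁ k : ℝ) z
    simp only [hNd, hn]; linarith
  have hrat : Tendsto (fun k => |(y₁ k : ℝ)| / N k) atTop (𝓝 1) := by
    rw [tendsto_iff_norm_sub_tendsto_zero]
    have hb : Tendsto (fun k => |(z : ℝ)| / N k) atTop (𝓝 0) := tendsto_const_nhds.div_atTop hN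
    refine squeeze_zero' (Eventually.of_forall fun _ => norm_nonneg _) ?_ hb
    filter_upwards [hN.eventually_gt_atTop 0] with k hk
    have e : |(y₁ k : ℝ)| / N k - 1 = (|(y₁ k : ℝ)| - N k) / N k := by field_simp
    rw [e, Real.norm_eq_abs, abs_div, abs_of_pos hk]
    refine div_le_div_of_nonneg_right ?_ hk.le
    have := abs_abs_sub_abs_le (y₁ k : ℝ) (n k)
    simpa [hn, hNd] using this
  have hm : Tendsto (fun k => (((y₂ k).natAbs : ℕ) : ℝ) ^ 2 / N k) atTop (𝓝 0) := by
    have h := hratio.mul hrat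
    rw [zero_mul] at h
    refine h.congr' ?_
    filter_upwards [hN.eventually_gt_atTop 0, hy.eventually_gt_atTop 0] with k hk hk2
    have : (((y₂ k).natAbs : ℕ) : ℝ) ^ 2 = (y₂ k : ℝ) ^ 2 := by
      rw [Nat.cast_natAbs, Int.cast_abs, sq_abs]
    rw [this]
    field_simp
  have hmain := half_lim (fun k => (y₂ k).natAbs) ε N hε hN hm
  have h2 := (hrat.sqrt.mul hmain).const_mul 2
  have e : 2 * (√1 * (√2 / 4 * limL)) = √2 / 2 * limL := by rw [Real.sqrt_one]; ring
  rw [e] at h2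
  have h3 := (Complex.continuous_ofReal.tendsto _).comp h2
  refine h3.congr' ?_
  filter_upwards [hN.eventually_gt_atTop 0] with k hk
  have e1 : ∀ t : ℝ, Complex.exp (Complex.I * t * ((y₁ k : ℂ) - (z : ℂ))) *
      psiFn t ^ (y₂ k).natAbs / (1 - (phiFn t : ℂ)) =
      Complex.exp (Complex.I * t * (ε k * N k)) * fFn (y₂ k).natAbs t := by
    intro t
    rw [← Complex.ofReal_mul, hεN, fFn, mul_div_assoc]
    simp [hn]
  simp only [e1]
  rw [full_eq, ← Complex.ofReal_mul]
  simp only [Function.comp]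
  congr 1
  rw [Real.sqrt_div (abs_nonneg _)]
  have hq := Real.sqrt_pos.2 hk
  generalize (∫ t in (0 : ℝ)..π,
    Complex.exp (Complex.I * t * (ε k * N k)) * fFn (y₂ k).natAbs t).re = R
  field_simp
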